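/- Let C be an m×n Cauchon diagram and let I ⊆ [m], J ⊆ [n] with |I| = |J| = k. Then det_q(M_C[I,J]) = Σ_P sgn_q(P)·w(P), where the sum is over ALL (R_I,C_J)-path systems P in the Cauchon graph G_C. -/

import Mathlib

universe u

/-- Quantum affine space data: a central unit `q` and units `t i j`
satisfying the quantum affine space commutation relations. -/
structure QMData (R : Type u) [Ring R] (m n : ℕ) where
  q : Rˣ
  t : Fin m → Fin n → Rˣ
  q_central : ∀ r : R, (q : R) * r = r * (q : R)
  row_rel : ∀ (i : Fin m) ⦃j j' : Fin n⦄, j < j' →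
    (t i j : R) * (t i j' : R) = (q : R) * ((t i j' : R) * (t i j : R))
  col_rel : ∀ ⦃i i' : Fin m⦄ (j : Fin n), i < i' →
    (t i j : R) * (t i' j : R) = (q : R) * ((t i' j : R) * (t i j : R))
  mixed_rel : ∀ ⦃i i' : Fin m⦄ ⦃j j' : Fin n⦄, i < i' → j ≠ j' →
    (t i j : R) * (t i' j' : R) = (t i' j' : R) * (t i j : R)

/-- `white i j = true` means the square `(i,j)` is white.  The Cauchon
condition: for every black square, either every square above it or every
square to its left is also black. -/
def IsCauchon {m n : ℕ} (white : Fin m → Fin n → Bool) : Prop :=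
  ∀ i j, white i j = false →
    (∀ i' : Fin m, i' < i → white i' j = false) ∨
    (∀ j' : Fin n, j' < j → white i j' = false)

/-- Vertices of the Cauchon graph: white squares, row vertices `r_i`,
column vertices `c_j`. -/
inductive CVertex (m n : ℕ) where
  | sq : Fin m → Fin n → CVertex m n
  | row : Fin m → CVertex m n
  | col : Fin n → CVertex m n
deriving DecidableEq

/-- Directed edges of the Cauchon graph. -/
inductive CEdge {m n : ℕ} (white : Fin m → Fin n → Bool) :
    CVertex m n → CVertex m n → Prop where
  | fromRow (i : Fin m) (k : Fin n) :
      white i k = true → (∀ k' : Fin n, k < k' → white i k' = false) →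
      CEdge white (.row i) (.sq i k)
  | toCol (i : Fin m) (j : Fin n) :
      white i j = true → (∀ i' : Fin m, i < i' → white i' j = false) →
      CEdge white (.sq i j) (.col j)
  | horiz (i : Fin m) (k j : Fin n) :
      j < k → white i k = true → white i j = true →
      (∀ j' : Fin n, j < j' → j' < k → white i j' = false) →
      CEdge white (.sq i k) (.sq i j)
  | vert (i i' : Fin m) (j : Fin n) :
      i < i' → white i j = true → white i' j = true →
      (∀ l : Fin m, i < l → l < i' → white l j = false) →
      CEdge white (.sq i j) (.sq i' j)

/-- The weight of an edge of the Cauchon graph (1 on non-edges). -/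
def wt {R : Type u} {m n : ℕ} [Ring R] (D : QMData R m n) :
    CVertex m n → CVertex m n → R
  | .row i, .sq i' k => if i = i' then (D.t i' k : R) else 1
  | .sq i k, .sq i' j =>
      if i = i' ∧ j < k then (↑((D.t i k)⁻¹) * ↑(D.t i j) : R) else 1
  | _, _ => 1

/-- A pair of vertices spans a horizontal edge (edges from `r_i` are
horizontal; edges between squares are horizontal iff the rows agree). -/
def Horiz {m n : ℕ} : CVertex m n → CVertex m n → Prop
  | .row _, _ => True
  | .sq i _, .sq i' _ => i = i'
  | _, _ => False

/-- `l` is (the list of vertices of) a directed path from `u` to `v`. -/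
def IsPathFrom {m n : ℕ} (white : Fin m → Fin n → Bool) (u v : CVertex m n)
    (l : List (CVertex m n)) : Prop :=
  l.Chain' (CEdge white) ∧ l.head? = some u ∧ l.getLast? = some v

/-- The list of (endpoint pairs of the) edges of a path. -/
def steps {m n : ℕ} (l : List (CVertex m n)) : List (CVertex m n × CVertex m n) :=
  l.zip l.tail

/-- The weight of a path: the ordered product of its edge weights. -/
def pathWeight {R : Type u} {m n : ℕ} [Ring R] (D : QMData R m n)
    (l : List (CVertex m n)) : R :=
  ((steps l).map fun p => wt D p.1 p.2).prod

/-- The number of inversions (length) of a permutation of `Fin k`. -/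
def invCount {k : ℕ} (σ : Equiv.Perm (Fin k)) : ℕ :=
  ((Finset.univ : Finset (Fin k × Fin k)).filter fun p => p.1 < p.2 ∧ σ p.2 < σ p.1).card

/-- The quantum determinant of a `k × k` matrix over a (noncommutative) ring. -/
def qdet {R : Type u} [Ring R] {k : ℕ} (q : Rˣ) (N : Matrix (Fin k) (Fin k) R) : R :=
  ∑ σ : Equiv.Perm (Fin k),
    (-(q : R)) ^ invCount σ * ((List.finRange k).map fun i => N i (σ i)).prod

/-- The path matrix: entry `(i,j)` is the sum of the weights of all directed
paths from `r_i` to `c_j` (zero when there are none). -/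
noncomputable def pathMatrix {R : Type u} {m n : ℕ} [Ring R] (D : QMData R m n)
    (white : Fin m → Fin n → Bool) : Matrix (Fin m) (Fin n) R :=
  Matrix.of fun i j =>
    ∑ᶠ p : {l : List (CVertex m n) // IsPathFrom white (.row i) (.col j) l},
      pathWeight D p.1

/-- An `(R_I, C_J)`-path system: paths `P ℓ : r_{i_ℓ} ⇒ c_{j_{σ ℓ}}`. -/
structure PathSys {m n : ℕ} (white : Fin m → Fin n → Bool) {k : ℕ}
    (ι : Fin k → Fin m) (κ : Fin k → Fin n) where
  σ : Equiv.Perm (Fin k)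
  P : Fin k → List (CVertex m n)
  isPath : ∀ l : Fin k, IsPathFrom white (.row (ι l)) (.col (κ (σ l))) (P l)

/-- A path system is vertex-disjoint if no two of its paths share a vertex. -/
def PathSys.VertexDisjoint {m n : ℕ} {white : Fin m → Fin n → Bool} {k : ℕ}
    {ι : Fin k → Fin m} {κ : Fin k → Fin n} (S : PathSys white ι κ) : Prop :=
  ∀ a b : Fin k, a ≠ b → ∀ x : CVertex m n, x ∈ S.P a → x ∈ S.P b → False

/-- The weight of a path system: the ordered product `w(P₁)⋯w(P_k)`. -/
def PathSys.weight {R : Type u} {m n : ℕ} [Ring R] (D : QMData R m n)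
    {white : Fin m → Fin n → Bool} {k : ℕ} {ι : Fin k → Fin m} {κ : Fin k → Fin n}
    (S : PathSys white ι κ) : R :=
  ((List.finRange k).map fun l => pathWeight D (S.P l)).prod

/-- The `q`-sign of a path system: `(-q) ^ ℓ(σ_P)`. -/
def PathSys.sgnq {R : Type u} {m n : ℕ} [Ring R] (D : QMData R m n)
    {white : Fin m → Fin n → Bool} {k : ℕ} {ι : Fin k → Fin m} {κ : Fin k → Fin n}
    (S : PathSys white ι κ) : R :=
  (-(D.q : R)) ^ invCount S.σ


/-- A height function on the vertices which increases strictly along every edge. -/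
def CVertex.height {m n : ℕ} : CVertex m n → ℕ
  | .row _ => 0
  | .sq i j => 1 + i + (n - j)
  | .col _ => m + n + 1

theorem CEdge.height_lt {m n : ℕ} {white : Fin m → Fin n → Bool} {u v : CVertex m n}
    (h : CEdge white u v) : u.height < v.height := by
  cases h <;> simp only [CVertex.height, Fin.lt_def] at * <;> omega

instance CVertex.instFinite (m n : ℕ) : Finite (CVertex m n) := by
  refine Finite.of_surjective
    (Sum.elim (fun p => .sq p.1 p.2) (Sum.elim .row .col) :
      (Fin m × Fin n) ⊕ (Fin m ⊕ Fin n) → CVertex m n) ?_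
  rintro (⟨i, j⟩ | i | j)
  · exact ⟨.inl (i, j), rfl⟩
  · exact ⟨.inr (.inl i), rfl⟩
  · exact ⟨.inr (.inr j), rfl⟩

theorem IsPathFrom.nodup {m n : ℕ} {white : Fin m → Fin n → Bool} {u v : CVertex m n}
    {l : List (CVertex m n)} (h : IsPathFrom white u v l) : l.Nodup := by
  have hchain : l.IsChain fun a b => a.height < b.height :=
    List.IsChain.imp (fun _ _ hab => hab.height_lt) h.1
  have : IsTrans (CVertex m n) fun a b => a.height < b.height := ⟨fun _ _ _ => lt_trans⟩
  exact hchain.pairwise.imp fun hab hne => absurd (congrArg CVertex.height hne) hab.ne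

instance finite_isPathFrom {m n : ℕ} (white : Fin m → Fin n → Bool) (u v : CVertex m n) :
    Finite {l : List (CVertex m n) // IsPathFrom white u v l} :=
  ((List.finite_length_le (CVertex m n) (Nat.card (CVertex m n))).subset fun l hl => by
    have := Fintype.ofFinite (CVertex m n)
    rw [Nat.card_eq_fintype_card]
    exact IsPathFrom.nodup hl |>.length_le_card).to_subtype

/-- Distributivity of an ordered product of finite sums in a noncommutative semiring. -/
theorem List.prod_finRange_sum {R : Type*} [Semiring R] {k : ℕ} {α : Fin k → Type*}
    [∀ i, Fintype (α i)] (f : ∀ i, α i → R) :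
    ((List.finRange k).map fun i => ∑ a, f i a).prod =
      ∑ p : ∀ i, α i, ((List.finRange k).map fun i => f i (p i)).prod := by
  induction k with
  | zero => simp
  | succ k ih =>
    rw [← (Fin.consEquiv α).sum_comp, Fintype.sum_prod_type]
    simp [List.finRange_succ, Function.comp_def, Fin.consEquiv, ih, Finset.sum_mul_sum]

/-- A path system is a permutation together with a compatible family of paths. -/
def PathSys.equivSigma {m n : ℕ} (white : Fin m → Fin n → Bool) {k : ℕ}
    (ι : Fin k → Fin m) (κ : Fin k → Fin n) :
    PathSys white ι κ ≃ Σ σ : Equiv.Perm (Fin k), ∀ l : Fin k,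
      {p : List (CVertex m n) // IsPathFrom white (.row (ι l)) (.col (κ (σ l))) p} where
  toFun S := ⟨S.σ, fun l => ⟨S.P l, S.isPath l⟩⟩
  invFun S := ⟨S.1, fun l => (S.2 l).1, fun l => (S.2 l).2⟩
  left_inv _ := rfl
  right_inv _ := rfl

/-- `det_q(M_C[I,J])` equals the signed weighted sum over ALL
`(R_I, C_J)`-path systems. -/
theorem qdet_eq_sum_all_path_systems {R : Type u} [Ring R] {m n : ℕ} (D : QMData R m n)
    (white : Fin m → Fin n → Bool) (hC : IsCauchon white)
    {k : ℕ} (ι : Fin k → Fin m) (κ : Fin k → Fin n)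
    (hι : StrictMono ι) (hκ : StrictMono κ) :
    qdet D.q (Matrix.of fun a b : Fin k => pathMatrix D white (ι a) (κ b)) =
      ∑ᶠ S : PathSys white ι κ, S.sgnq D * S.weight D := by
  classical
  have (u v : CVertex m n) : Fintype {l : List (CVertex m n) // IsPathFrom white u v l} :=
    Fintype.ofFinite _
  rw [← finsum_comp_equiv (PathSys.equivSigma white ι κ).symm, finsum_eq_sum_of_fintype,
    Fintype.sum_sigma]
  simp only [qdet, pathMatrix, Matrix.of_apply, finsum_eq_sum_of_fintype,
    List.prod_finRange_sum, Finset.mul_sum]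
  rfl
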